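/- Let A be an n×n matrix with ε-quasiseparable rank at most k, for some ε > 0. Then there exists a matrix δA with ‖δA‖₂ ≤ 2·√n·ε such that A + δA has (exact) quasiseparable rank at most k, i.e., every submatrix of A + δA contained entirely in the strictly lower or strictly upper triangular part has rank at most k. -/

import Mathlib

open Matrix

/-- The spectral norm (operator 2-norm) of a matrix. -/
noncomputable def specNorm {𝕜 : Type*} [RCLike 𝕜] {m n : ℕ}
    (M : Matrix (Fin m) (Fin n) 𝕜) : ℝ :=
  ‖LinearMap.toContinuousLinearMap (Matrix.toEuclideanLin M)‖

/-- The lower off-diagonal block `A[p+1:n, 1:p]` (1-based indexing). -/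
def lowerBlock {α : Type*} {n : ℕ} (A : Matrix (Fin n) (Fin n) α) (p : ℕ) (hp : p < n) :
    Matrix (Fin (n - p)) (Fin p) α :=
  A.submatrix (fun i => ⟨p + i.1, by have := i.2; omega⟩) (fun j => ⟨j.1, by have := j.2; omega⟩)

/-- The upper off-diagonal block `A[1:p, p+1:n]` (1-based indexing). -/
def upperBlock {α : Type*} {n : ℕ} (A : Matrix (Fin n) (Fin n) α) (p : ℕ) (hp : p < n) :
    Matrix (Fin p) (Fin (n - p)) α :=
  A.submatrix (fun i => ⟨i.1, by have := i.2; omega⟩) (fun j => ⟨p + j.1, by have := j.2; omega⟩)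

/-- `A` has `ε`-quasiseparable rank at most `k`: every off-diagonal block admits a rank-`≤ k`
approximation within `ε` in the spectral norm (equivalently, `σ_{k+1}` of every off-diagonal
block is at most `ε`). -/
def EpsQSRankLE {𝕜 : Type*} [RCLike 𝕜] {n : ℕ} (A : Matrix (Fin n) (Fin n) 𝕜)
    (ε : ℝ) (k : ℕ) : Prop :=
  ∀ (p : ℕ), 1 ≤ p → ∀ hp : p < n,
    (∃ M, M.rank ≤ k ∧ specNorm (lowerBlock A p hp - M) ≤ ε) ∧
    (∃ M, M.rank ≤ k ∧ specNorm (upperBlock A p hp - M) ≤ ε)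

/-- `A` has lower quasiseparable rank at most `k`: every submatrix contained entirely in the
strictly lower triangular part has rank at most `k`. -/
def LowerQSRankLE {𝕜 : Type*} [Field 𝕜] {n : ℕ} (A : Matrix (Fin n) (Fin n) 𝕜) (k : ℕ) : Prop :=
  ∀ (u v : ℕ) (r : Fin u → Fin n) (c : Fin v → Fin n),
    (∀ i j, (c j : ℕ) < (r i : ℕ)) → (A.submatrix r c).rank ≤ k

/-- `A` has upper quasiseparable rank at most `k`: every submatrix contained entirely in the
strictly upper triangular part has rank at most `k`. -/
def UpperQSRankLE {𝕜 : Type*} [Field 𝕜] {n : ℕ} (A : Matrix (Fin n) (Fin n) 𝕜) (k : ℕ) : Prop :=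
  ∀ (u v : ℕ) (r : Fin u → Fin n) (c : Fin v → Fin n),
    (∀ i j, (r i : ℕ) < (c j : ℕ)) → (A.submatrix r c).rank ≤ k

/-- `A` has quasiseparable rank at most `k`. -/
def QSRankLE {𝕜 : Type*} [Field 𝕜] {n : ℕ} (A : Matrix (Fin n) (Fin n) 𝕜) (k : ℕ) : Prop :=
  LowerQSRankLE A k ∧ UpperQSRankLE A k

open scoped Matrix.Norms.L2Operator ComplexOrder

lemma specNorm_eq {m n : ℕ} (M : Matrix (Fin m) (Fin n) ℂ) : specNorm M = ‖M‖ := rfl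

/-- Orthogonal projection onto the row space of `N`. -/
lemma exists_proj {n : ℕ} (N : Matrix (Fin n) (Fin n) ℂ) :
    ∃ P : Matrix (Fin n) (Fin n) ℂ, Pᴴ = P ∧ P * P = P ∧ N * P = N ∧ P.rank ≤ N.rank ∧
      ∀ Q : Matrix (Fin n) (Fin n) ℂ, N * Qᴴ = N → Q * P = P := by
  classical
  let Φ := Matrix.toEuclideanCLM (n := Fin n) (𝕜 := ℂ)
  let T := Φ Nᴴ
  let U := LinearMap.range T.toLinearMap
  let P := Φ.symm U.starProjection
  have hΦP : Φ P = U.starProjection := Φ.apply_symm_apply _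
  have h1 : Pᴴ = P := by
    apply EquivLike.injective Φ
    rw [← Matrix.star_eq_conjTranspose, map_star, hΦP]
    exact (isSelfAdjoint_starProjection U)
  have h3 : P * Nᴴ = Nᴴ := by
    apply EquivLike.injective Φ
    rw [map_mul, hΦP]
    ext1 x
    exact Submodule.starProjection_eq_self_iff.2 ⟨x, rfl⟩
  refine ⟨P, h1, ?_, ?_, ?_, ?_⟩
  · apply EquivLike.injective Φ
    rw [map_mul, hΦP]
    exact U.isIdempotentElem_starProjection
  · have := congrArg conjTranspose h3
    simpa [conjTranspose_mul, h1] using this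
  · have hr : ∀ X : Matrix (Fin n) (Fin n) ℂ, X.rank = Module.finrank ℂ (LinearMap.range (Φ X).toLinearMap) := by
      intro X
      exact Matrix.rank_eq_finrank_range_toLin X (EuclideanSpace.basisFun (Fin n) ℂ).toBasis (EuclideanSpace.basisFun (Fin n) ℂ).toBasis
    rw [← Matrix.rank_conjTranspose N, hr, hr, hΦP]
    apply Submodule.finrank_mono
    rintro _ ⟨x, rfl⟩
    exact U.starProjection_apply_mem x
  · intro Q hQ
    have hQ' : Q * Nᴴ = Nᴴ := by
      have := congrArg conjTranspose hQ
      simpa [conjTranspose_mul] using this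
    apply EquivLike.injective Φ
    rw [map_mul, hΦP]
    ext1 x
    obtain ⟨y, hy⟩ := U.starProjection_apply_mem x
    have : Φ Q * Φ Nᴴ = Φ Nᴴ := by rw [← map_mul, hQ']
    change Φ Q (U.starProjection x) = U.starProjection x
    rw [← hy]
    exact congrArg (fun f => f y) this

lemma norm_proj_le {n : ℕ} (P : Matrix (Fin n) (Fin n) ℂ) (h1 : Pᴴ = P) (h2 : P * P = P) :
    ‖P‖ ≤ 1 := by
  have := Matrix.l2_opNorm_conjTranspose_mul_self P
  rw [h1, h2] at this
  by_contra h
  push Not at h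
  nlinarith

lemma norm_iso_le {m n : ℕ} (X : Matrix (Fin m) (Fin n) ℂ) (h1 : Xᴴ * X = 1) :
    ‖X‖ ≤ 1 := by
  have := Matrix.l2_opNorm_conjTranspose_mul_self X
  rw [h1] at this
  have h2 : ‖(1 : Matrix (Fin n) (Fin n) ℂ)‖ ≤ 1 := norm_proj_le 1 (by simp) (by simp)
  by_contra h
  push Not at h
  nlinarith

/-- mask of indices `≥ p` -/
def Fm (n p : ℕ) : Matrix (Fin n) (Fin n) ℂ := diagonal fun i => if p ≤ i.1 then 1 else 0
/-- mask of indices `< p` -/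
def Dm (n p : ℕ) : Matrix (Fin n) (Fin n) ℂ := diagonal fun i => if i.1 < p then 1 else 0
/-- mask of index `p` -/
def Em (n p : ℕ) : Matrix (Fin n) (Fin n) ℂ := diagonal fun i => if i.1 = p then 1 else 0

lemma Fm_mul (n p m : ℕ) (h : m ≤ p) : Fm n p * Fm n m = Fm n p := by
  simp only [Fm, diagonal_mul_diagonal, diagonal_eq_diagonal_iff]; intro i; split_ifs <;> first | (exfalso; omega) | simp
lemma Dm_succ (n p : ℕ) : Dm n (p+1) = Dm n p + Em n p := by
  simp only [Dm, Em, diagonal_add, diagonal_eq_diagonal_iff]; intro i; split_ifs <;> first | (exfalso; omega) | simp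
lemma Em_mul_Dm (n p q : ℕ) (h : q ≤ p) : Em n p * Dm n q = 0 := by
  simp only [Dm, Em, diagonal_mul_diagonal]; rw [diagonal_eq_zero]; ext i; simp only [Pi.zero_apply]; split_ifs <;> first | (exfalso; omega) | simp
lemma Em_mul_Dm' (n p q : ℕ) (h : p < q) : Em n p * Dm n q = Em n p := by
  simp only [Dm, Em, diagonal_mul_diagonal, diagonal_eq_diagonal_iff]; intro i; split_ifs <;> first | (exfalso; omega) | simp
lemma Dm_mul_Dm (n p q : ℕ) (h : p ≤ q) : Dm n p * Dm n q = Dm n p := by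
  simp only [Dm, diagonal_mul_diagonal, diagonal_eq_diagonal_iff]; intro i; split_ifs <;> first | (exfalso; omega) | simp
lemma Em_mul_Em (n p : ℕ) : Em n p * Em n p = Em n p := by
  simp only [Em, diagonal_mul_diagonal, diagonal_eq_diagonal_iff]; intro i; split_ifs <;> first | (exfalso; omega) | simp
lemma Em_herm (n p : ℕ) : (Em n p)ᴴ = Em n p := by
  simp only [Em, diagonal_conjTranspose, diagonal_eq_diagonal_iff]; intro i; simp only [Pi.star_apply]; split_ifs <;> simp
lemma Dm_herm (n p : ℕ) : (Dm n p)ᴴ = Dm n p := by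
  simp only [Dm, diagonal_conjTranspose, diagonal_eq_diagonal_iff]; intro i; simp only [Pi.star_apply]; split_ifs <;> simp

lemma exists_padded {n : ℕ} (A : Matrix (Fin n) (Fin n) ℂ) (ε : ℝ) (k : ℕ) (hε : 0 < ε)
    (hA : ∀ (p : ℕ), 1 ≤ p → ∀ hp : p < n,
      ∃ M, M.rank ≤ k ∧ specNorm (lowerBlock A p hp - M) ≤ ε) (p : ℕ) :
    ∃ M : Matrix (Fin n) (Fin n) ℂ, M.rank ≤ k ∧ ‖Fm n p * A * Dm n p - M‖ ≤ ε := by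
  by_cases hp1 : 1 ≤ p
  swap
  · have : p = 0 := by omega
    subst this
    have h0 : Dm n 0 = 0 := by simp [Dm]
    exact ⟨0, by simp, by simp [h0, hε.le]⟩
  by_cases hp : p < n
  swap
  · have h0 : Fm n p = 0 := by
      unfold Fm; rw [diagonal_eq_zero]; ext i; have := i.2; simp; omega
    exact ⟨0, by simp, by simp [h0, hε.le]⟩
  obtain ⟨M, hM, hn⟩ := hA p hp1 hp
  rw [specNorm_eq] at hn
  obtain ⟨X, hXd⟩ : ∃ X : Matrix (Fin n) (Fin (n-p)) ℂ, ∀ i a, X i a = if i.1 = p + a.1 then 1 else 0 := ⟨fun i a => _, fun _ _ => rfl⟩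
  obtain ⟨Y, hYd⟩ : ∃ X : Matrix (Fin n) (Fin p) ℂ, ∀ i a, X i a = if i.1 = a.1 then 1 else 0 := ⟨fun i a => _, fun _ _ => rfl⟩
  have hX : Xᴴ * X = 1 := by
    ext a b
    rw [mul_apply, Finset.sum_eq_single ⟨p + a.1, by omega⟩]
    · simp [hXd, one_apply, Fin.ext_iff]
    · intro i _ hi
      have : i.1 ≠ p + a.1 := fun h => hi (Fin.ext h)
      simp [hXd, this]
    · simp
  have hY : Yᴴ * Y = 1 := by
    ext a b
    rw [mul_apply, Finset.sum_eq_single ⟨a.1, by omega⟩]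
    · simp [hYd, one_apply, Fin.ext_iff]
    · intro i _ hi
      have : i.1 ≠ a.1 := fun h => hi (Fin.ext h)
      simp [hYd, this]
    · simp
  have hL : lowerBlock A p hp = Xᴴ * A * Y := by
    ext a b
    rw [mul_apply, Finset.sum_eq_single ⟨b.1, by omega⟩]
    · rw [mul_apply, Finset.sum_eq_single ⟨p + a.1, by omega⟩]
      · simp [hXd, hYd, lowerBlock]
      · intro i _ hi
        have : i.1 ≠ p + a.1 := fun h => hi (Fin.ext h)
        simp [hXd, this]
      · simp
    · intro i _ hi
      have : i.1 ≠ b.1 := fun h => hi (Fin.ext h)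
      simp [hYd, this]
    · simp
  have hXX : X * Xᴴ = Fm n p := by
    ext i j
    rw [mul_apply]
    by_cases h : p ≤ i.1
    · rw [Finset.sum_eq_single ⟨i.1 - p, by omega⟩]
      · simp only [hXd, Fm, conjTranspose_apply, diagonal_apply, Fin.ext_iff]
        split_ifs <;> first | (exfalso; omega) | simp
      · intro a _ ha
        have : i.1 ≠ p + a.1 := fun h => ha (Fin.ext (by simp; omega))
        simp [hXd, this]
      · simp
    · rw [Finset.sum_eq_zero]
      · simp [Fm, diagonal_apply, h]
      · intro a _
        have : i.1 ≠ p + a.1 := by omega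
        simp [hXd, this]
  have hYY : Y * Yᴴ = Dm n p := by
    ext i j
    rw [mul_apply]
    by_cases h : i.1 < p
    · rw [Finset.sum_eq_single ⟨i.1, by omega⟩]
      · simp only [hYd, Dm, conjTranspose_apply, diagonal_apply, Fin.ext_iff]
        split_ifs <;> first | (exfalso; omega) | simp
      · intro a _ ha
        have : i.1 ≠ a.1 := fun h => ha (Fin.ext (by simp; omega))
        simp [hYd, this]
      · simp
    · rw [Finset.sum_eq_zero]
      · simp [Dm, diagonal_apply, h]
      · intro a _
        have : i.1 ≠ a.1 := by omega
        simp [hYd, this]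
  refine ⟨X * M * Yᴴ, ((rank_mul_le_left _ _).trans (rank_mul_le_right _ _)).trans hM, ?_⟩
  have e : Fm n p * A * Dm n p - X * M * Yᴴ = X * (lowerBlock A p hp - M) * Yᴴ := by
    rw [hL, ← hXX, ← hYY]; simp only [Matrix.mul_sub, Matrix.sub_mul, Matrix.mul_assoc]
  rw [e]
  have h1 := norm_iso_le X hX
  have h2 : ‖Yᴴ‖ ≤ 1 := by rw [l2_opNorm_conjTranspose]; exact norm_iso_le Y hY
  calc _ ≤ ‖X * (lowerBlock A p hp - M)‖ * ‖Yᴴ‖ := l2_opNorm_mul _ _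
    _ ≤ ‖X‖ * ‖lowerBlock A p hp - M‖ * ‖Yᴴ‖ := by gcongr; exact l2_opNorm_mul _ _
    _ ≤ 1 * ε * 1 := by gcongr
    _ = ε := by ring

lemma Dm_mul_Em (n p q : ℕ) (h : q ≤ p) : Dm n q * Em n p = 0 := by
  have := congrArg conjTranspose (Em_mul_Dm n p q h)
  simpa [conjTranspose_mul, Em_herm, Dm_herm] using this

lemma exists_chain {n : ℕ} (M : ℕ → Matrix (Fin n) (Fin n) ℂ) :
    ∃ P : ℕ → Matrix (Fin n) (Fin n) ℂ, P 0 = 0 ∧ (∀ p, (P p)ᴴ = P p) ∧ (∀ p, P p * P p = P p) ∧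
      (∀ p, P p * Dm n p = P p) ∧ (∀ p, (P (p+1)).rank ≤ (M (p+1)).rank) ∧
      (∀ p, (P p + Em n p) * P (p+1) = P (p+1)) ∧
      (∀ p, M (p+1) * (P p + Em n p) * P (p+1) = M (p+1) * (P p + Em n p)) := by
  choose pr h1 h2 h3 h4 h5 using fun N : Matrix (Fin n) (Fin n) ℂ => exists_proj N
  let P : ℕ → Matrix (Fin n) (Fin n) ℂ := fun p =>
    Nat.rec 0 (fun p Pp => pr (M (p+1) * (Pp + Em n p))) p
  have hS : ∀ p, P (p+1) = pr (M (p+1) * (P p + Em n p)) := fun p => rfl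
  have h0 : P 0 = 0 := rfl
  clear_value P
  have hH : ∀ p, (P p)ᴴ = P p := by
    intro p; cases p with
    | zero => simp [h0]
    | succ p => rw [hS]; exact h1 _
  have hI : ∀ p, P p * P p = P p := by
    intro p; cases p with
    | zero => simp [h0]
    | succ p => rw [hS]; exact h2 _
  have hQH : ∀ p, (P p + Em n p)ᴴ = P p + Em n p := by
    intro p; rw [conjTranspose_add, hH, Em_herm]
  have hQQ : ∀ p, P p * Dm n p = P p → (P p + Em n p) * (P p + Em n p) = P p + Em n p := by
    intro p hp
    have a1 : P p * Em n p = 0 := by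
      rw [← hp, Matrix.mul_assoc, Dm_mul_Em n p p le_rfl, Matrix.mul_zero]
    have a2 : Em n p * P p = 0 := by
      have := congrArg conjTranspose a1
      simpa [conjTranspose_mul, Em_herm, hH] using this
    rw [Matrix.mul_add, Matrix.add_mul, Matrix.add_mul, a1, a2, hI, Em_mul_Em]; simp
  have hQP : ∀ p, P p * Dm n p = P p → (P p + Em n p) * P (p+1) = P (p+1) := by
    intro p hp
    rw [hS p]
    apply h5
    rw [hQH, Matrix.mul_assoc, hQQ p hp]
  have hD : ∀ p, P p * Dm n p = P p := by
    intro p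
    induction p with
    | zero => simp [h0]
    | succ p ih =>
      have a1 : P (p+1) * (P p + Em n p) = P (p+1) := by
        have := congrArg conjTranspose (hQP p ih)
        rwa [conjTranspose_mul, hQH, hH] at this
      have a2 : (P p + Em n p) * Dm n (p+1) = P p + Em n p := by
        rw [Matrix.add_mul, Em_mul_Dm' n p _ (Nat.lt_succ_self p)]
        congr 1
        conv_lhs => rw [← ih]
        rw [Matrix.mul_assoc, Dm_mul_Dm n p _ (Nat.le_succ p), ih]
      rw [← a1, Matrix.mul_assoc, a2]
  refine ⟨P, h0, hH, hI, hD, ?_, fun p => hQP p (hD p), ?_⟩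
  · intro p; rw [hS]; exact (h4 _).trans (rank_mul_le_left _ _)
  · intro p; rw [hS]; exact h3 _

lemma main_lower {n : ℕ} (A : Matrix (Fin n) (Fin n) ℂ) (ε : ℝ) (k : ℕ) (hε : 0 < ε)
    (hA : ∀ (p : ℕ), 1 ≤ p → ∀ hp : p < n,
      ∃ M, M.rank ≤ k ∧ specNorm (lowerBlock A p hp - M) ≤ ε) :
    ∃ X : Matrix (Fin n) (Fin n) ℂ, ‖X‖ ≤ Real.sqrt n * ε ∧
      (∀ i j : Fin n, i.1 ≤ j.1 → X i j = 0) ∧ LowerQSRankLE (A + X) k := by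
  choose M hMr hMn using exists_padded A ε k hε hA
  obtain ⟨P, h0, hH, hI, hD, hr, hQP, hM⟩ := exists_chain M
  have hQH : ∀ p, (P p + Em n p)ᴴ = P p + Em n p := by
    intro p; rw [conjTranspose_add, hH, Em_herm]
  have hPQ : ∀ p, P (p+1) * (P p + Em n p) = P (p+1) := by
    intro p
    have := congrArg conjTranspose (hQP p)
    rwa [conjTranspose_mul, hQH, hH] at this
  have hPE : ∀ p, P p * Em n p = 0 := by
    intro p
    rw [← hD p, Matrix.mul_assoc, Dm_mul_Em n p p le_rfl, Matrix.mul_zero]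
  have hEP : ∀ p, Em n p * P p = 0 := by
    intro p
    have := congrArg conjTranspose (hPE p)
    simpa [conjTranspose_mul, Em_herm, hH] using this
  have hQQ : ∀ p, (P p + Em n p) * (P p + Em n p) = P p + Em n p := by
    intro p
    rw [Matrix.mul_add, Matrix.add_mul, Matrix.add_mul, hPE, hEP, hI, Em_mul_Em]; simp
  have hQD : ∀ p, (P p + Em n p) * Dm n (p+1) = P p + Em n p := by
    intro p
    rw [Matrix.add_mul, Em_mul_Dm' n p _ (Nat.lt_succ_self p)]
    congr 1
    conv_lhs => rw [← hD p]
    rw [Matrix.mul_assoc, Dm_mul_Dm n p _ (Nat.le_succ p), hD p]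
  obtain ⟨R, hR⟩ : ∃ R : ℕ → Matrix (Fin n) (Fin n) ℂ,
    ∀ p, R p = P p + Em n p - P (p+1) := ⟨_, fun _ => rfl⟩
  have hRH : ∀ p, (R p)ᴴ = R p := by
    intro p; rw [hR, conjTranspose_sub, hQH, hH]
  have hRR : ∀ p, R p * R p = R p := by
    intro p; rw [hR, Matrix.mul_sub, Matrix.sub_mul, Matrix.sub_mul, hQQ, hQP, hPQ, hI]; simp
  have hRD : ∀ p, R p * Dm n (p+1) = R p := by
    intro p; rw [hR, Matrix.sub_mul, hQD, hD]
  have hDR : ∀ p, Dm n (p+1) * R p = R p := by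
    intro p
    have := congrArg conjTranspose (hRD p)
    rwa [conjTranspose_mul, hRH, Dm_herm] at this
  have hPR : ∀ p d, P (p + 1 + d) * R p = 0 := by
    intro p d
    induction d with
    | zero => rw [hR, Matrix.mul_sub]; simp only [add_zero]; rw [hPQ, hI, sub_self]
    | succ d ih =>
      rw [← add_assoc, ← hPQ, Matrix.mul_assoc, Matrix.add_mul, ih, ← hDR, ← Matrix.mul_assoc,
        Em_mul_Dm n _ _ (by omega)]
      simp
  have hRR1 : ∀ p q, p < q → R q * R p = 0 := by
    intro p q h
    obtain ⟨d, rfl⟩ := Nat.exists_eq_add_of_lt h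
    have e1 : P (p + d + 1) * R p = 0 := by
      have := hPR p d
      rwa [show p + 1 + d = p + d + 1 by omega] at this
    have e2 : P (p + d + 1 + 1) * R p = 0 := by
      have := hPR p (d+1)
      rwa [show p + 1 + (d + 1) = p + d + 1 + 1 by omega] at this
    have e3 : Em n (p + d + 1) * R p = 0 := by
      rw [← hDR, ← Matrix.mul_assoc, Em_mul_Dm n _ _ (by omega), Matrix.zero_mul]
    rw [hR (p + d + 1), Matrix.sub_mul, Matrix.add_mul, e1, e2, e3]; simp
  have hRR0 : ∀ p q, p ≠ q → R p * R q = 0 := by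
    intro p q h
    rcases lt_or_gt_of_ne h with h | h
    · have := congrArg conjTranspose (hRR1 p q h)
      simpa [conjTranspose_mul, hRH] using this
    · exact hRR1 q p h
  obtain ⟨E, hE⟩ : ∃ E : ℕ → Matrix (Fin n) (Fin n) ℂ,
    ∀ p, E p = Fm n (p+1) * A * R p := ⟨_, fun _ => rfl⟩
  have hEn : ∀ p, ‖E p‖ ≤ ε := by
    intro p
    have hMR : M (p+1) * R p = 0 := by
      have : R p = (P p + Em n p) - (P p + Em n p) * P (p+1) := by rw [hR, hQP]
      rw [this, Matrix.mul_sub, ← Matrix.mul_assoc, hM, sub_self]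
    have : E p = (Fm n (p+1) * A * Dm n (p+1) - M (p+1)) * R p := by
      rw [Matrix.sub_mul, hMR, sub_zero, Matrix.mul_assoc _ (Dm n (p+1)), hDR, hE]
    rw [this]
    calc _ ≤ _ := l2_opNorm_mul _ _
      _ ≤ ε * 1 := by
        gcongr
        · exact hMn _
        · exact norm_proj_le _ (hRH p) (hRR p)
      _ = ε := mul_one _
  have hEE : ∀ p q, p ≠ q → E p * (E q)ᴴ = 0 := by
    intro p q h
    rw [hE, hE, conjTranspose_mul (Fm n (q+1) * A), hRH, Matrix.mul_assoc, ← Matrix.mul_assoc (R p),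
      hRR0 p q h]
    simp
  refine ⟨-∑ p ∈ Finset.range n, E p, ?_, ?_, ?_⟩
  · rw [norm_neg]
    set S := ∑ p ∈ Finset.range n, E p with hSd
    have h1 : S * Sᴴ = ∑ p ∈ Finset.range n, E p * (E p)ᴴ := by
      rw [hSd, conjTranspose_sum, Finset.sum_mul]
      apply Finset.sum_congr rfl
      intro p hp
      rw [Finset.mul_sum, Finset.sum_eq_single p]
      · intro q _ hq; exact hEE p q hq.symm
      · intro h; exact absurd hp h
    have h2 : ‖S‖ * ‖S‖ ≤ n * (ε * ε) := by
      have := l2_opNorm_conjTranspose_mul_self Sᴴ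
      rw [conjTranspose_conjTranspose, l2_opNorm_conjTranspose] at this
      rw [← this, h1]
      calc _ ≤ ∑ p ∈ Finset.range n, ‖E p * (E p)ᴴ‖ := norm_sum_le _ _
        _ ≤ ∑ p ∈ Finset.range n, ε * ε := by
          apply Finset.sum_le_sum
          intro p _
          refine (l2_opNorm_mul _ _).trans ?_
          rw [l2_opNorm_conjTranspose]
          exact mul_le_mul (hEn p) (hEn p) (norm_nonneg _) hε.le
        _ = _ := by simp
    refine (abs_le_of_sq_le_sq' ?_ (by positivity)).2
    have h3 : Real.sqrt n ^ 2 = n := Real.sq_sqrt (Nat.cast_nonneg n)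
    rw [mul_pow, h3]; nlinarith
  · intro i j hij
    rw [Matrix.neg_apply, Matrix.sum_apply, Finset.sum_eq_zero, neg_zero]
    intro p _
    rw [hE, ← hRD, ← Matrix.mul_assoc, Dm, mul_diagonal, Matrix.mul_assoc, Fm,
      diagonal_mul]
    by_cases h : p + 1 ≤ i.1
    · have : ¬ j.1 < p + 1 := by omega
      simp [this]
    · simp [h]
  · intro u v r c hrc
    set B := A + -∑ p ∈ Finset.range n, E p with hB
    rcases Nat.eq_zero_or_pos v with rfl | hv
    · exact (rank_le_width _).trans (Nat.zero_le _)
    rcases Nat.eq_zero_or_pos u with rfl | hu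
    · exact (rank_le_height _).trans (Nat.zero_le _)
    obtain ⟨j0, -, hj0⟩ := Finset.exists_max_image (Finset.univ : Finset (Fin v)) (fun j => (c j).1)
      ⟨⟨0, hv⟩, Finset.mem_univ _⟩
    set p := (c j0).1 with hp
    have hpn : p < n := (c j0).2
    have hDP : ∀ m, Dm n m - P m = ∑ q ∈ Finset.range m, R q := by
      intro m
      induction m with
      | zero => simp [h0, Dm]
      | succ m ih => rw [Finset.sum_range_succ, ← ih, hR, Dm_succ]; abel
    have hBR : ∀ m, m ≤ p → Fm n (p+1) * B * R m = 0 := by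
      intro m hm
      have e1 : (∑ q ∈ Finset.range n, E q) * R m = E m := by
        rw [Finset.sum_mul, Finset.sum_eq_single m]
        · rw [hE, Matrix.mul_assoc, hRR]
        · intro q _ hq; rw [hE, Matrix.mul_assoc, hRR0 q m hq, Matrix.mul_zero]
        · intro h; exact absurd (Finset.mem_range.2 (by omega)) h
      rw [Matrix.mul_assoc, hB, Matrix.add_mul, Matrix.neg_mul, e1, Matrix.mul_add, Matrix.mul_neg,
        hE, ← Matrix.mul_assoc, ← Matrix.mul_assoc, ← Matrix.mul_assoc, Fm_mul n _ _ (by omega),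
        add_neg_cancel]
    have hBP : Fm n (p+1) * B * Dm n (p+1) = Fm n (p+1) * B * P (p+1) := by
      rw [← sub_eq_zero, ← Matrix.mul_sub, hDP, Finset.mul_sum]
      apply Finset.sum_eq_zero
      intro m hm
      exact hBR m (by have := Finset.mem_range.1 hm; omega)
    have hsub : B.submatrix r c = (Fm n (p+1) * B * P (p+1)).submatrix r c := by
      rw [← hBP]
      ext i j
      have a1 : p + 1 ≤ (r i).1 := hrc i j0
      have a2 : (c j).1 < p + 1 := Nat.lt_succ_of_le (hj0 j (Finset.mem_univ _))
      rw [submatrix_apply, submatrix_apply, Dm, mul_diagonal, Fm, diagonal_mul]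
      simp [a1, a2]
    rw [hsub]
    have hfin : (Fm n (p+1) * B * P (p+1)).rank ≤ k :=
      (rank_mul_le_right _ _).trans ((hr p).trans (hMr _))
    exact (rank_submatrix_le _ _ _).trans hfin

/-- **An `ε`-quasiseparable matrix is `2√n·ε`-close to an exactly quasiseparable one.**
If `A` has `ε`-quasiseparable rank at most `k` with `ε > 0`, then there exists `δA` with
`‖δA‖₂ ≤ 2√n·ε` such that `A + δA` has quasiseparable rank at most `k`. -/
theorem exists_quasisep_approximant
    {n : ℕ} (A : Matrix (Fin n) (Fin n) ℂ) (ε : ℝ) (k : ℕ)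
    (hε : 0 < ε) (hA : EpsQSRankLE A ε k) :
    ∃ δA : Matrix (Fin n) (Fin n) ℂ,
      specNorm δA ≤ 2 * Real.sqrt n * ε ∧ QSRankLE (A + δA) k := by
  have hl := main_lower A ε k hε (fun p h1 hp => (hA p h1 hp).1)
  have hu := main_lower Aᴴ ε k hε (by
    intro p h1 hp
    obtain ⟨M, hM, hn⟩ := (hA p h1 hp).2
    refine ⟨Mᴴ, by rwa [rank_conjTranspose], ?_⟩
    have : lowerBlock Aᴴ p hp - Mᴴ = (upperBlock A p hp - M)ᴴ := by
      rw [conjTranspose_sub]; rfl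
    rw [this, specNorm_eq, l2_opNorm_conjTranspose]
    exact hn)
  obtain ⟨X, hX1, hX2, hX3⟩ := hl
  obtain ⟨Y, hY1, hY2, hY3⟩ := hu
  refine ⟨X + Yᴴ, ?_, ?_, ?_⟩
  · rw [specNorm_eq]
    calc _ ≤ ‖X‖ + ‖Yᴴ‖ := norm_add_le _ _
      _ ≤ Real.sqrt n * ε + Real.sqrt n * ε := by
        rw [l2_opNorm_conjTranspose]; exact add_le_add hX1 hY1
      _ = _ := by ring
  · intro u v r c h
    have e : (A + (X + Yᴴ)).submatrix r c = (A + X).submatrix r c := by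
      ext i j
      have := hY2 (c j) (r i) (h i j).le
      simp [this]
    rw [e]
    exact hX3 u v r c h
  · intro u v r c h
    have e : (A + (X + Yᴴ)).submatrix r c = ((Aᴴ + Y).submatrix c r)ᴴ := by
      ext i j
      have := hX2 (r i) (c j) (h i j).le
      simp [this]
    rw [e, rank_conjTranspose]
    exact hY3 v u c r (fun i j => h j i)
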